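/- Existence of extremal solutions: Let 0 < κ < μ < 1, ω > 0, z_a ∈ ℝ, and let F : [a,b] × ℝ → ℝ be continuous. Suppose z₀ is a lower solution and z̃₀ is an upper solution of the problem with z₀(ℓ) ≤ z̃₀(ℓ) for all ℓ ∈ [a,b], and that F(ℓ,x) ≤ F(ℓ,y) whenever z₀(ℓ) ≤ x ≤ y ≤ z̃₀(ℓ). Then there exist continuous functions z*, z̃* : [a,b] → ℝ with z₀ ≤ z* ≤ z̃* ≤ z̃₀ pointwise on [a,b], both satisfying the integral equation z(ℓ) = z_a + ∫_a^ℓ Φ'(ρ)(Φ(ℓ)−Φ(ρ))^{μ−1} E_{μ−κ,μ}(−ω(Φ(ℓ)−Φ(ρ))^{μ−κ}) F(ρ, z(ρ)) dρ on [a,b], such that every continuous solution z of this integral equation with z₀(ℓ) ≤ z(ℓ) ≤ z̃₀(ℓ) on [a,b] satisfies z*(ℓ) ≤ z(ℓ) ≤ z̃*(ℓ) for all ℓ ∈ [a,b]. -/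

import Mathlib

open Real MeasureTheory Set

/-- Two-parameter Mittag-Leffler function `E_{p,q}(x) = ∑_{k=0}^∞ x^k / Γ(pk+q)`. -/
noncomputable def mittagLeffler (p q x : ℝ) : ℝ :=
  ∑' k : ℕ, x ^ k / Real.Gamma (p * k + q)

theorem integral_Ioo_rpow_mul_sub_rpow {p q t : ℝ} (hp : 0 < p) (hq : 0 < q) (ht : 0 < t) :
    ∫ s in Ioo 0 t, s ^ (p - 1) * (t - s) ^ (q - 1) =
      Gamma p * Gamma q / Gamma (p + q) * t ^ (p + q - 1) := by
  have hG : Gamma (p + q) ≠ 0 := (Gamma_pos_of_pos (add_pos hp hq)).ne'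
  have h1 := Complex.betaIntegral_scaled (p : ℂ) (q : ℂ) ht
  have h2 := Complex.Gamma_mul_Gamma_eq_betaIntegral (s := (p : ℂ)) (t := (q : ℂ))
    (by simpa) (by simpa)
  rw [intervalIntegral.integral_of_le ht.le, integral_Ioc_eq_integral_Ioo] at h1
  have h3 : ∫ s in Ioo 0 t, (s : ℂ) ^ ((p : ℂ) - 1) * ((t : ℂ) - s) ^ ((q : ℂ) - 1) =
      ((∫ s in Ioo 0 t, s ^ (p - 1) * (t - s) ^ (q - 1) : ℝ) : ℂ) := by
    rw [← integral_complex_ofReal]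
    refine setIntegral_congr_fun measurableSet_Ioo fun s hs => ?_
    rw [Complex.ofReal_mul, Complex.ofReal_cpow hs.1.le, Complex.ofReal_cpow (sub_pos.2 hs.2).le]
    push_cast
    rfl
  rw [h3] at h1
  rw [← Complex.ofReal_add, Complex.Gamma_ofReal, Complex.Gamma_ofReal, Complex.Gamma_ofReal] at h2
  have h4 : Complex.betaIntegral p q = ((Gamma p * Gamma q / Gamma (p + q) : ℝ) : ℂ) := by
    push_cast
    rw [h2, mul_div_cancel_left₀ _ (by exact_mod_cast hG)]
  rw [h4] at h1
  have h5 : (t : ℂ) ^ ((p : ℂ) + q - 1) = ((t ^ (p + q - 1) : ℝ) : ℂ) := by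
    rw [Complex.ofReal_cpow ht.le]; push_cast; rfl
  rw [h5] at h1
  rw [mul_comm]
  exact_mod_cast h1

theorem integrableOn_Ioo_rpow_mul_sub_rpow {p q t : ℝ} (hp : 0 < p) (hq : 0 < q) (ht : 0 < t) :
    IntegrableOn (fun s => s ^ (p - 1) * (t - s) ^ (q - 1)) (Ioo 0 t) := by
  refine Integrable.of_integral_ne_zero ?_
  rw [integral_Ioo_rpow_mul_sub_rpow hp hq ht]
  have := Gamma_pos_of_pos hp
  have := Gamma_pos_of_pos hq
  have := Gamma_pos_of_pos (add_pos hp hq)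
  positivity

theorem rpow_mul_exp_le_Gamma {R y : ℝ} (hR : 0 < R) (hy : 1 ≤ y) :
    R ^ (y - 1) * exp (-(R + 1)) ≤ Gamma y := by
  have hy0 : 0 < y := by linarith
  have hint := GammaIntegral_convergent hy0
  rw [Gamma_eq_integral hy0]
  calc R ^ (y - 1) * exp (-(R + 1))
      = ∫ _ in Ioc R (R + 1), exp (-(R + 1)) * R ^ (y - 1) := by simp [mul_comm]
    _ ≤ ∫ x in Ioc R (R + 1), exp (-x) * x ^ (y - 1) := by
        refine setIntegral_mono_on (integrableOn_const (by simp))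
          (hint.mono_set fun x hx => hR.trans hx.1) measurableSet_Ioc fun x hx => ?_
        have hx0 : 0 < x := hR.trans hx.1
        have h1 : R ^ (y - 1) ≤ x ^ (y - 1) := rpow_le_rpow hR.le hx.1.le (by linarith)
        have h2 : exp (-(R + 1)) ≤ exp (-x) := exp_le_exp.2 (by linarith [hx.2])
        gcongr
    _ ≤ ∫ x in Ioi 0, exp (-x) * x ^ (y - 1) := by
        refine setIntegral_mono_set hint ?_ ?_
        · filter_upwards [ae_restrict_mem measurableSet_Ioi] with x hx
          have : (0 : ℝ) < x := hx
          simp only [Pi.zero_apply]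
          positivity
        · exact Filter.Eventually.of_forall fun x hx => hR.trans hx.1

theorem summable_mittagLeffler {p q : ℝ} (hp : 0 < p) (hq : 0 < q) (x : ℝ) :
    Summable fun k : ℕ => ‖x ^ k / Gamma (p * k + q)‖ := by
  set B : ℝ := 2 * (|x| + 1) with hB
  have hB0 : 0 < B := by positivity
  set R : ℝ := B ^ (1 / p) with hR
  have hR0 : 0 < R := by positivity
  have hRp : R ^ p = B := by
    rw [hR, ← rpow_mul hB0.le, one_div_mul_cancel hp.ne', rpow_one]
  have hg : Summable fun k : ℕ => (R ^ (q - 1) * exp (-(R + 1)))⁻¹ * (1 / 2 : ℝ) ^ k :=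
    (summable_geometric_of_lt_one (by norm_num) (by norm_num)).mul_left _
  refine Summable.of_norm_bounded_eventually_nat hg ?_
  obtain ⟨N, hN⟩ := exists_nat_ge (1 / p)
  filter_upwards [Filter.eventually_ge_atTop N] with k hk
  have hk1 : 1 ≤ p * k + q := by
    have : 1 / p ≤ k := hN.trans (by exact_mod_cast hk)
    rw [div_le_iff₀ hp] at this
    linarith
  have hΓ := rpow_mul_exp_le_Gamma hR0 hk1
  have hpow : R ^ (p * k + q - 1) = B ^ k * R ^ (q - 1) := by
    rw [add_sub_assoc, rpow_add hR0, rpow_mul hR0.le, hRp, rpow_natCast]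
  rw [hpow] at hΓ
  have hΓ0 : 0 < Gamma (p * k + q) := Gamma_pos_of_pos (by linarith)
  have hx : |x| ^ k ≤ (B / 2) ^ k := by
    gcongr
    rw [hB]; linarith
  rw [norm_norm, norm_div, norm_pow, norm_eq_abs, norm_of_nonneg hΓ0.le]
  have hc : 0 < R ^ (q - 1) * exp (-(R + 1)) := by positivity
  calc |x| ^ k / Gamma (p * k + q)
      ≤ (B / 2) ^ k / (B ^ k * R ^ (q - 1) * exp (-(R + 1))) := by gcongr
    _ = _ := by
        rw [div_pow, one_div, inv_pow]
        field_simp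

theorem differentiable_mittagLeffler {p q : ℝ} (hp : 0 < p) (hq : 0 < q) :
    Differentiable ℝ (mittagLeffler p q) := by
  set S := FormalMultilinearSeries.ofScalars ℝ (fun k : ℕ => (Gamma (p * k + q))⁻¹) with hS
  have hrad : S.radius = ⊤ := by
    refine S.radius_eq_top_of_summable_norm fun r => ?_
    refine Summable.of_nonneg_of_le (fun k => by positivity) (fun k => ?_)
      (summable_mittagLeffler hp hq r)
    have := FormalMultilinearSeries.ofScalars_norm_eq_mul (E := ℝ) (𝕜 := ℝ)
      (fun k : ℕ => (Gamma (p * k + q))⁻¹) k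
    rw [hS, norm_div, norm_pow, div_eq_mul_inv, mul_comm ]
    simp
  have hsum : S.sum = mittagLeffler p q := by
    funext x
    simp [FormalMultilinearSeries.sum, mittagLeffler, hS, div_eq_mul_inv]
  have h := S.hasFPowerSeriesOnBall (by rw [hrad]; exact ENNReal.zero_lt_top)
  rw [hrad, hsum] at h
  intro x
  exact (h.differentiableOn.differentiableAt (by simp))

theorem integrableOn_rpow_mul_mittagLeffler_mul_sub_rpow {p q r t : ℝ} (hp : 0 < p) (hq : 0 < q)
    (hr : 0 < r) (c : ℝ) (ht : 0 < t) :
    IntegrableOn (fun s => s ^ (q - 1) * mittagLeffler p q (c * s ^ p) * (t - s) ^ (r - 1))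
      (Ioo 0 t) := by
  have h1 := integrableOn_Ioo_rpow_mul_sub_rpow hq hr ht
  have h2 : Continuous fun s : ℝ => mittagLeffler p q (c * s ^ p) :=
    (differentiable_mittagLeffler hp hq).continuous.comp
      (continuous_const.mul (continuous_id.rpow_const fun _ => Or.inr hp.le))
  rw [← integrableOn_Icc_iff_integrableOn_Ioo] at h1 ⊢
  refine (h1.mul_continuousOn h2.continuousOn isCompact_Icc).congr_fun (fun s _ => ?_)
    measurableSet_Icc
  ring

theorem integral_rpow_mul_mittagLeffler_mul_sub_rpow {p q r t : ℝ} (hp : 0 < p) (hq : 0 < q)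
    (hr : 0 < r) (c : ℝ) (ht : 0 < t) :
    ∫ s in Ioo 0 t, s ^ (q - 1) * mittagLeffler p q (c * s ^ p) * (t - s) ^ (r - 1) =
      Gamma r * t ^ (q + r - 1) * mittagLeffler p (q + r) (c * t ^ p) := by
  have hpos : ∀ n : ℕ, 0 < p * n + q := fun n => by positivity
  have hΓ : ∀ n : ℕ, 0 < Gamma (p * n + q) := fun n => Gamma_pos_of_pos (hpos n)
  have hΓr : 0 < Gamma r := Gamma_pos_of_pos hr
  have hterm : ∀ (d : ℝ) (n : ℕ),
      d / Gamma (p * n + q) *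
        (∫ s in Ioo 0 t, s ^ (p * n + q - 1) * (t - s) ^ (r - 1)) =
      Gamma r * t ^ (q + r - 1) * (d * (t ^ p) ^ n / Gamma (p * n + (q + r))) := by
    intro d n
    rw [integral_Ioo_rpow_mul_sub_rpow (hpos n) hr ht, ← add_assoc,
      show p * n + q + r - 1 = q + r - 1 + p * n by ring, rpow_add ht, rpow_mul ht.le,
      rpow_natCast]
    have := (hΓ n).ne'
    field_simp
  set f : ℕ → ℝ → ℝ := fun n s =>
    c ^ n / Gamma (p * n + q) * (s ^ (p * n + q - 1) * (t - s) ^ (r - 1)) with hf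
  have hint : ∀ n, Integrable (f n) (volume.restrict (Ioo 0 t)) := fun n =>
    (integrableOn_Ioo_rpow_mul_sub_rpow (hpos n) hr ht).const_mul _
  have hnorm : ∀ n, ∫ s in Ioo 0 t, ‖f n s‖ =
      Gamma r * t ^ (q + r - 1) * ((|c| * t ^ p) ^ n / Gamma (p * n + (q + r))) := by
    intro n
    rw [mul_pow, ← hterm, ← integral_const_mul]
    refine setIntegral_congr_fun measurableSet_Ioo fun s hs => ?_
    have h1 : 0 < s := hs.1
    have h2 : 0 < t - s := sub_pos.2 hs.2
    simp only [hf]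
    rw [norm_mul, norm_div, norm_pow, norm_eq_abs, norm_of_nonneg (hΓ n).le,
      norm_of_nonneg (by positivity)]
  have hsum : Summable fun n => ∫ s in Ioo 0 t, ‖f n s‖ := by
    simp_rw [hnorm]
    exact ((summable_mittagLeffler hp (add_pos hq hr) _).of_norm).mul_left _
  have h := hasSum_integral_of_summable_integral_norm hint hsum
  have hlhs : ∀ n, ∫ s in Ioo 0 t, f n s =
      Gamma r * t ^ (q + r - 1) * ((c * t ^ p) ^ n / Gamma (p * n + (q + r))) := by
    intro n
    rw [mul_pow, ← hterm, ← integral_const_mul]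
  rw [mittagLeffler, ← tsum_mul_left]
  simp_rw [← hlhs]
  rw [h.tsum_eq]
  refine setIntegral_congr_fun measurableSet_Ioo fun s hs => ?_
  have h1 : 0 < s := hs.1
  simp only [hf, mittagLeffler]
  rw [← tsum_mul_left, ← tsum_mul_right]
  refine tsum_congr fun n => ?_
  rw [show p * n + q - 1 = q - 1 + p * n by ring, rpow_add h1, rpow_mul h1.le, rpow_natCast,
    mul_pow]
  ring

/-- `E_{p,1}(x) = 1 + x E_{p,p+1}(x)`. -/
theorem mittagLeffler_one_eq {p : ℝ} (hp : 0 < p) (x : ℝ) :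
    mittagLeffler p 1 x = 1 + x * mittagLeffler p (p + 1) x := by
  rw [mittagLeffler, ((summable_mittagLeffler hp one_pos x).of_norm).tsum_eq_zero_add,
    mittagLeffler, ← tsum_mul_left]
  congr 1
  · simp
  · refine tsum_congr fun n => ?_
    push_cast
    rw [pow_succ, show p * (n + 1 : ℝ) + 1 = p * n + (p + 1) by ring]
    ring

/-- The kernel `t^{μ-1} E_{μ-κ,μ}(-ω t^{μ-κ})` of the solution representation. -/
noncomputable def solutionKernel (μ κ ω t : ℝ) : ℝ :=
  t ^ (μ - 1) * mittagLeffler (μ - κ) μ (-ω * t ^ (μ - κ))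

/-- The kernel `t^{-μ}/Γ(1-μ) + ω t^{-κ}/Γ(1-κ)` of the two-term Caputo operator. -/
noncomputable def caputoKernel (μ κ ω t : ℝ) : ℝ :=
  1 / Gamma (1 - μ) * t ^ (-μ) + ω * (1 / Gamma (1 - κ) * t ^ (-κ))

section Kernels

variable {μ κ ω : ℝ}

theorem integral_solutionKernel_mul_caputoKernel (hκ0 : 0 < κ) (hκμ : κ < μ) (hμ1 : μ < 1)
    {t : ℝ} (ht : 0 < t) :
    ∫ s in Ioo 0 t, solutionKernel μ κ ω s * caputoKernel μ κ ω (t - s) = 1 := by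
  have hp : 0 < μ - κ := sub_pos.2 hκμ
  have hμ0 : 0 < μ := hκ0.trans hκμ
  have h1μ : 0 < 1 - μ := sub_pos.2 hμ1
  have h1κ : 0 < 1 - κ := by linarith
  have iμ := integrableOn_rpow_mul_mittagLeffler_mul_sub_rpow hp hμ0 h1μ (-ω) ht
  have iκ := integrableOn_rpow_mul_mittagLeffler_mul_sub_rpow hp hμ0 h1κ (-ω) ht
  have eμ := integral_rpow_mul_mittagLeffler_mul_sub_rpow hp hμ0 h1μ (-ω) ht
  have eκ := integral_rpow_mul_mittagLeffler_mul_sub_rpow hp hμ0 h1κ (-ω) ht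
  have hsplit : ∀ s, solutionKernel μ κ ω s * caputoKernel μ κ ω (t - s) =
      1 / Gamma (1 - μ) *
        (s ^ (μ - 1) * mittagLeffler (μ - κ) μ (-ω * s ^ (μ - κ)) * (t - s) ^ (1 - μ - 1)) +
      ω / Gamma (1 - κ) *
        (s ^ (μ - 1) * mittagLeffler (μ - κ) μ (-ω * s ^ (μ - κ)) * (t - s) ^ (1 - κ - 1)) := by
    intro s
    rw [solutionKernel, caputoKernel, show 1 - μ - 1 = -μ by ring, show 1 - κ - 1 = -κ by ring]
    ring
  simp_rw [hsplit]
  rw [integral_add (iμ.const_mul _) (iκ.const_mul _), integral_const_mul, integral_const_mul,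
    eμ, eκ, show μ + (1 - μ) = 1 by ring, show μ + (1 - κ) = μ - κ + 1 by ring,
    mittagLeffler_one_eq hp, sub_self, rpow_zero, add_sub_cancel_right]
  have h1 := (Gamma_pos_of_pos h1μ).ne'
  have h2 := (Gamma_pos_of_pos h1κ).ne'
  field_simp
  ring

theorem integrableOn_solutionKernel (hκ0 : 0 < κ) (hκμ : κ < μ) (T : ℝ) :
    IntegrableOn (solutionKernel μ κ ω) (Ioo 0 T) := by
  rcases le_or_gt T 0 with hT | hT
  · simp [Ioo_eq_empty hT.not_gt]
  · have h := integrableOn_rpow_mul_mittagLeffler_mul_sub_rpow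
      (sub_pos.2 hκμ) (hκ0.trans hκμ) one_pos (-ω) hT
    simp only [sub_self, rpow_zero, mul_one] at h
    exact h

theorem integrableOn_caputoKernel (hκμ : κ < μ) (hμ1 : μ < 1) (T : ℝ) :
    IntegrableOn (caputoKernel μ κ ω) (Ioo 0 T) := by
  rcases le_or_gt T 0 with hT | hT
  · simp [Ioo_eq_empty hT.not_gt]
  · have h : ∀ r : ℝ, r < 1 → IntegrableOn (fun s : ℝ => s ^ (-r)) (Ioo 0 T) := fun r hr =>
      (intervalIntegral.integrableOn_Ioo_rpow_iff hT).2 (by linarith)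
    exact ((h μ hμ1).const_mul _).add (((h κ (hκμ.trans hμ1)).const_mul _).const_mul _)

theorem differentiableAt_solutionKernel (hκ0 : 0 < κ) (hκμ : κ < μ) {t : ℝ} (ht : 0 < t) :
    DifferentiableAt ℝ (solutionKernel μ κ ω) t := by
  have h : ∀ r : ℝ, DifferentiableAt ℝ (fun s : ℝ => s ^ r) t := fun r =>
    (hasDerivAt_rpow_const (Or.inl ht.ne')).differentiableAt
  exact (h _).mul (((differentiable_mittagLeffler (sub_pos.2 hκμ) (hκ0.trans hκμ)) _).comp t
    ((h _).const_mul (-ω)))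

theorem continuousOn_caputoKernel : ContinuousOn (caputoKernel μ κ ω) (Ioi 0) := by
  have h : ∀ r : ℝ, ContinuousOn (fun s : ℝ => s ^ r) (Ioi 0) := fun r =>
    continuousOn_id.rpow_const fun x hx => Or.inl (ne_of_gt hx)
  exact ((h _).const_mul _).add (((h _).const_mul _).const_mul _)

theorem caputoKernel_nonneg (hκμ : κ < μ) (hμ1 : μ < 1) (hω : 0 < ω) {t : ℝ} (ht : 0 < t) :
    0 ≤ caputoKernel μ κ ω t := by
  have h1 := Gamma_pos_of_pos (sub_pos.2 hμ1)
  have h2 := Gamma_pos_of_pos (sub_pos.2 (hκμ.trans hμ1))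
  rw [caputoKernel]
  positivity

theorem exists_mul_sub_le_caputoKernel_sub (hκ0 : 0 < κ) (hκμ : κ < μ) (hμ1 : μ < 1)
    (hω : 0 < ω) {T : ℝ} (hT : 0 < T) :
    ∃ c > 0, ∀ u v, 0 < u → u ≤ v → v ≤ T →
      c * (v - u) ≤ caputoKernel μ κ ω u - caputoKernel μ κ ω v := by
  have hμ0 := hκ0.trans hκμ
  have h1 := Gamma_pos_of_pos (sub_pos.2 hμ1)
  have h2 := Gamma_pos_of_pos (sub_pos.2 (hκμ.trans hμ1))
  refine ⟨1 / Gamma (1 - μ) * (μ * T ^ (-μ - 1)), by positivity, fun u v hu huv hv => ?_⟩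
  have hv0 := hu.trans_le huv
  have hd : ∀ x ∈ Icc u v, HasDerivAt (fun s : ℝ => s ^ (-μ)) (-μ * x ^ (-μ - 1)) x := fun x hx =>
    hasDerivAt_rpow_const (Or.inl (hu.trans_le hx.1).ne')
  have hmv := (convex_Icc u v).image_sub_le_mul_sub_of_deriv_le
    (f := fun s : ℝ => s ^ (-μ)) (C := -(μ * T ^ (-μ - 1)))
    (fun x hx => (hd x hx).continuousAt.continuousWithinAt)
    (fun x hx => (hd x (interior_subset hx)).differentiableAt.differentiableWithinAt)
    (fun x hx => by
      have hx' := interior_subset hx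
      rw [(hd x hx').deriv, neg_mul, neg_le_neg_iff]
      exact mul_le_mul_of_nonneg_left (rpow_le_rpow_of_nonpos (hu.trans_le hx'.1)
        (hx'.2.trans hv) (by linarith)) hμ0.le)
    u (left_mem_Icc.2 huv) v (right_mem_Icc.2 huv) huv
  have hk : v ^ (-κ) ≤ u ^ (-κ) := rpow_le_rpow_of_nonpos hu huv (by linarith)
  have hk' : ω * (1 / Gamma (1 - κ) * v ^ (-κ)) ≤ ω * (1 / Gamma (1 - κ) * u ^ (-κ)) := by gcongr
  have hm' : 1 / Gamma (1 - μ) * (μ * T ^ (-μ - 1) * (v - u)) ≤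
      1 / Gamma (1 - μ) * (u ^ (-μ) - v ^ (-μ)) := by
    gcongr
    linarith
  rw [caputoKernel, caputoKernel]
  linarith

theorem continuousOn_integral_Ioo {k : ℝ → ℝ} (hk : ∀ T, IntegrableOn k (Ioo 0 T)) :
    ContinuousOn (fun T => ∫ s in Ioo 0 T, k s) (Ici 0) := by
  intro x hx
  have h := intervalIntegral.continuousOn_primitive
    ((integrableOn_Icc_iff_integrableOn_Ioo).2 (hk (x + 1)))
  simp_rw [integral_Ioc_eq_integral_Ioo] at h
  have hx0 : 0 ≤ x := hx
  refine (h x ⟨hx0, by linarith⟩).mono_of_mem_nhdsWithin ?_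
  filter_upwards [self_mem_nhdsWithin, mem_nhdsWithin_of_mem_nhds (Iio_mem_nhds (lt_add_one x))]
    with y hy hy' using ⟨hy, le_of_lt hy'⟩

/-- If `k` is nonnegative and locally uniformly strictly decreasing, then a kernel `G` with
`∫₀ᵗ G(s) k(t-s) ds = 1` which starts out positive never vanishes: at a first zero the
increment of the convolution would be negative. -/
theorem pos_of_convolution_eq_one {G k : ℝ → ℝ}
    (hGd : ∀ t > 0, DifferentiableAt ℝ G t)
    (hG0 : ∃ δ > 0, ∀ t ∈ Ioo 0 δ, 0 < G t)
    (hGi : ∀ T, IntegrableOn G (Ioo 0 T)) (hki : ∀ T, IntegrableOn k (Ioo 0 T))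
    (hk0 : ∀ t > 0, 0 ≤ k t)
    (hk : ∀ T > 0, ∃ c > 0, ∀ u v, 0 < u → u ≤ v → v ≤ T → c * (v - u) ≤ k u - k v)
    (hconv : ∀ t > 0, ∫ s in Ioo 0 t, G s * k (t - s) = 1) :
    ∀ t > 0, 0 < G t := by
  by_contra! ⟨t₁, ht₁, hGt₁⟩
  obtain ⟨δ, hδ, hGδ⟩ := hG0
  have hδt₁ : δ ≤ t₁ := by
    by_contra! h
    exact (hGδ t₁ ⟨ht₁, h⟩).not_ge hGt₁
  obtain ⟨t₀, ⟨⟨hδt₀, ht₀t₁⟩, hGt₀⟩, hleast⟩ :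
      ∃ t₀, IsLeast (Icc δ t₁ ∩ G ⁻¹' Iic 0) t₀ := by
    refine IsCompact.exists_isLeast ?_ ⟨t₁, ⟨hδt₁, le_rfl⟩, hGt₁⟩
    refine isCompact_Icc.of_isClosed_subset
      (ContinuousOn.preimage_isClosed_of_isClosed (fun x hx => ?_) isClosed_Icc isClosed_Iic)
      inter_subset_left
    exact (hGd x (hδ.trans_le hx.1)).continuousAt.continuousWithinAt
  have ht₀ : 0 < t₀ := hδ.trans_le hδt₀
  have hGpos : ∀ s, 0 < s → s < t₀ → 0 < G s := by
    intro s hs hst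
    by_contra! h
    rcases lt_or_ge s δ with hsδ | hsδ
    · exact (hGδ s ⟨hs, hsδ⟩).not_ge h
    · exact (hleast ⟨⟨hsδ, hst.le.trans ht₀t₁⟩, h⟩).not_gt hst
  obtain ⟨L, hL, hLO⟩ := (hGd t₀ ht₀).isBigO_sub.exists_pos
  obtain ⟨η, hη, hηL⟩ := Metric.eventually_nhds_iff.1 hLO.bound
  obtain ⟨c, hc, hck⟩ := hk t₀ ht₀
  set I := ∫ s in Ioo 0 (t₀ / 2), G s with hI
  have hIpos : 0 < I := by
    rw [hI, setIntegral_pos_iff_support_of_nonneg_ae]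
    · have : Function.support G ∩ Ioo 0 (t₀ / 2) = Ioo 0 (t₀ / 2) :=
        inter_eq_right.2 fun s hs => (hGpos s hs.1 (by linarith [hs.2])).ne'
      rw [this, Real.volume_Ioo]
      simpa using ht₀
    · filter_upwards [ae_restrict_mem measurableSet_Ioo] with s hs
      exact (hGpos s hs.1 (by linarith [hs.2])).le
    · exact hGi _
  obtain ⟨h, hh0, hhη, hht, hhk⟩ : ∃ h > 0, h < η ∧ h < t₀ / 2 ∧
      L * ∫ s in Ioo 0 h, k s < c * I := by
    have h1 := ((continuousOn_integral_Ioo hki) 0 self_mem_Ici).mono Ioi_subset_Ici_self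
    have h2 := (h1.const_mul L).eventually_lt_const (u := c * I) (by simp; positivity)
    have h3 : ∀ᶠ x in nhdsWithin (0 : ℝ) (Ioi 0), x < η :=
      mem_nhdsWithin_of_mem_nhds (Iio_mem_nhds hη)
    have h4 : ∀ᶠ x in nhdsWithin (0 : ℝ) (Ioi 0), x < t₀ / 2 :=
      mem_nhdsWithin_of_mem_nhds (Iio_mem_nhds (by positivity))
    obtain ⟨x, ⟨⟨hx1, hx2⟩, hx3⟩, hx4⟩ :=
      (((h2.and h3).and h4).and self_mem_nhdsWithin).exists
    exact ⟨x, hx4, hx2, hx3, hx1⟩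
  have hth : 0 < t₀ - h := by linarith
  have hci : ∀ t > 0, IntegrableOn (fun s => G s * k (t - s)) (Ioo 0 t) := fun t ht =>
    Integrable.of_integral_ne_zero (by rw [hconv t ht]; exact one_ne_zero)
  have hunion : Ioo 0 (t₀ - h) ∪ Ico (t₀ - h) t₀ = Ioo 0 t₀ :=
    Ioo_union_Ico_eq_Ioo hth (by linarith)
  have hi1 : IntegrableOn (fun s => G s * k (t₀ - s)) (Ioo 0 (t₀ - h)) :=
    (hci t₀ ht₀).mono_set (hunion ▸ subset_union_left)
  have hi2 : IntegrableOn (fun s => G s * k (t₀ - s)) (Ico (t₀ - h) t₀) :=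
    (hci t₀ ht₀).mono_set (hunion ▸ subset_union_right)
  have hsplit : (∫ s in Ioo 0 (t₀ - h), G s * (k (t₀ - h - s) - k (t₀ - s))) =
      ∫ s in Ico (t₀ - h) t₀, G s * k (t₀ - s) := by
    have e1 := setIntegral_union (Set.disjoint_left.2 fun x hx hx' => hx.2.not_ge hx'.1)
      measurableSet_Ico hi1 hi2
    rw [hunion, hconv t₀ ht₀] at e1
    simp_rw [mul_sub]
    rw [integral_sub (hci _ hth) hi1, hconv _ hth]
    linarith
  have hdiff : ∀ s, 0 < s → s < t₀ - h → c * h ≤ k (t₀ - h - s) - k (t₀ - s) := by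
    intro s hs hs'
    have := hck (t₀ - h - s) (t₀ - s) (by linarith) (by linarith) (by linarith)
    rwa [show t₀ - s - (t₀ - h - s) = h by ring] at this
  have hlower : c * h * I ≤ ∫ s in Ioo 0 (t₀ - h), G s * (k (t₀ - h - s) - k (t₀ - s)) := by
    have hi : IntegrableOn (fun s => G s * (k (t₀ - h - s) - k (t₀ - s))) (Ioo 0 (t₀ - h)) := by
      simp_rw [mul_sub]
      exact (hci _ hth).sub hi1
    have hsub : Ioo 0 (t₀ / 2) ⊆ Ioo 0 (t₀ - h) := Ioo_subset_Ioo_right (by linarith)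
    calc c * h * I = ∫ s in Ioo 0 (t₀ / 2), c * h * G s := by rw [integral_const_mul]
      _ ≤ ∫ s in Ioo 0 (t₀ / 2), G s * (k (t₀ - h - s) - k (t₀ - s)) := by
          refine setIntegral_mono_on ((hGi _).const_mul _) (hi.mono_set hsub) measurableSet_Ioo
            fun s hs => ?_
          rw [mul_comm]
          exact mul_le_mul_of_nonneg_left (hdiff s hs.1 (hsub hs).2)
            (hGpos s hs.1 (by linarith [hs.2])).le
      _ ≤ _ := by
          refine setIntegral_mono_set hi ?_ hsub.eventuallyLE
          filter_upwards [ae_restrict_mem measurableSet_Ioo] with s hs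
          exact mul_nonneg (hGpos s hs.1 (by linarith [hs.2])).le
            ((by positivity : 0 ≤ c * h).trans (hdiff s hs.1 hs.2))
  have hrefl : IntegrableOn (fun s => k (t₀ - s)) (Ico (t₀ - h) t₀) ∧
      ∫ s in Ico (t₀ - h) t₀, k (t₀ - s) = ∫ s in Ioo 0 h, k s := by
    have hki' : IntervalIntegrable k volume 0 h :=
      (intervalIntegrable_iff_integrableOn_Ioo_of_le hh0.le).2 (hki h)
    constructor
    · have := hki'.comp_sub_left t₀
      rw [sub_zero] at this
      exact (intervalIntegrable_iff_integrableOn_Ico_of_le (by linarith)).1 this.symm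
    · have := intervalIntegral.integral_comp_sub_left (a := t₀ - h) (b := t₀) k t₀
      rw [intervalIntegral.integral_of_le (by linarith), integral_Ioc_eq_integral_Ioo, sub_self,
        sub_sub_cancel, intervalIntegral.integral_of_le hh0.le, integral_Ioc_eq_integral_Ioo]
        at this
      rw [integral_Ico_eq_integral_Ioo, this]
  have hupper : ∫ s in Ico (t₀ - h) t₀, G s * k (t₀ - s) ≤ L * h * ∫ s in Ioo 0 h, k s := by
    rw [← hrefl.2, ← integral_const_mul]
    refine setIntegral_mono_on hi2 (hrefl.1.const_mul _) measurableSet_Ico fun s hs => ?_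
    refine mul_le_mul_of_nonneg_right ?_ (hk0 _ (sub_pos.2 hs.2))
    have h1 : |s - t₀| ≤ h := by rw [abs_le]; constructor <;> linarith [hs.1, hs.2]
    have h2 := hηL (y := s) (by rw [Real.dist_eq]; linarith)
    rw [norm_eq_abs, norm_eq_abs] at h2
    have h3 : L * |s - t₀| ≤ L * h := by gcongr
    have h4 : G t₀ ≤ 0 := hGt₀
    linarith [le_abs_self (G s - G t₀)]
  rw [hsplit] at hlower
  nlinarith [hlower.trans hupper]

theorem solutionKernel_pos (hκ0 : 0 < κ) (hκμ : κ < μ) (hμ1 : μ < 1) (hω : 0 < ω) {t : ℝ}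
    (ht : 0 < t) : 0 < solutionKernel μ κ ω t := by
  have hp := sub_pos.2 hκμ
  have hμ0 := hκ0.trans hκμ
  refine pos_of_convolution_eq_one (k := caputoKernel μ κ ω)
    (fun t ht => differentiableAt_solutionKernel hκ0 hκμ ht) ?_
    (integrableOn_solutionKernel hκ0 hκμ) (integrableOn_caputoKernel hκμ hμ1)
    (fun t ht => caputoKernel_nonneg hκμ hμ1 hω ht)
    (fun T hT => exists_mul_sub_le_caputoKernel_sub hκ0 hκμ hμ1 hω hT)
    (fun t ht => integral_solutionKernel_mul_caputoKernel hκ0 hκμ hμ1 ht) t ht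
  have hcont : Continuous fun s : ℝ => mittagLeffler (μ - κ) μ (-ω * s ^ (μ - κ)) :=
    (differentiable_mittagLeffler hp hμ0).continuous.comp
      (continuous_const.mul (continuous_id.rpow_const fun _ => Or.inr hp.le))
  have h0 : 0 < mittagLeffler (μ - κ) μ (-ω * 0 ^ (μ - κ)) := by
    rw [zero_rpow hp.ne', mul_zero, mittagLeffler, tsum_eq_single 0 (by simp_all)]
    simpa using Gamma_pos_of_pos hμ0
  obtain ⟨δ, hδ, hball⟩ := Metric.eventually_nhds_iff.1 (hcont.continuousAt.eventually_const_lt h0)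
  refine ⟨δ, hδ, fun s hs => mul_pos (rpow_pos_of_pos hs.1 _) (hball ?_)⟩
  rw [Real.dist_eq, sub_zero, abs_of_pos hs.1]
  exact hs.2

end Kernels

/-- `Φ` is continuously differentiable on `[a, b]` with positive derivative `Φ'`. -/
structure IsTimeChange (Φ Φ' : ℝ → ℝ) (a b : ℝ) : Prop where
  hasDerivAt : ∀ x ∈ Icc a b, HasDerivAt Φ (Φ' x) x
  continuousOn_deriv : ContinuousOn Φ' (Icc a b)
  deriv_pos : ∀ x ∈ Icc a b, 0 < Φ' x

namespace IsTimeChange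

variable {Φ Φ' : ℝ → ℝ} {a b : ℝ}

theorem continuousOn (h : IsTimeChange Φ Φ' a b) : ContinuousOn Φ (Icc a b) :=
  fun x hx => (h.hasDerivAt x hx).continuousAt.continuousWithinAt

theorem strictMonoOn (h : IsTimeChange Φ Φ' a b) : StrictMonoOn Φ (Icc a b) :=
  strictMonoOn_of_deriv_pos (convex_Icc a b) h.continuousOn fun x hx => by
    rw [(h.hasDerivAt x (interior_subset hx)).deriv]
    exact h.deriv_pos x (interior_subset hx)

theorem image_Ioo (h : IsTimeChange Φ Φ' a b) {s l : ℝ} (hs : a ≤ s) (hsl : s ≤ l) (hl : l ≤ b) :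
    (fun ρ => Φ l - Φ ρ) '' Ioo s l = Ioo 0 (Φ l - Φ s) := by
  have hsub : Icc s l ⊆ Icc a b := Icc_subset_Icc hs hl
  apply Subset.antisymm
  · rintro _ ⟨ρ, hρ, rfl⟩
    have h1 := h.strictMonoOn (hsub ⟨le_rfl, hsl⟩) (hsub (Ioo_subset_Icc_self hρ)) hρ.1
    have h2 := h.strictMonoOn (hsub (Ioo_subset_Icc_self hρ)) (hsub ⟨hsl, le_rfl⟩) hρ.2
    constructor <;> linarith
  · have := intermediate_value_Ioo' hsl (f := fun ρ => Φ l - Φ ρ)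
      (continuousOn_const.sub (h.continuousOn.mono hsub))
    rwa [sub_self] at this

theorem hasDerivWithinAt_sub (h : IsTimeChange Φ Φ' a b) {s l : ℝ} (hs : a ≤ s) (hl : l ≤ b) :
    ∀ x ∈ Ioo s l, HasDerivWithinAt (fun ρ => Φ l - Φ ρ) (-Φ' x) (Ioo s l) x := fun x hx =>
  ((h.hasDerivAt x ⟨hs.trans hx.1.le, hx.2.le.trans hl⟩).const_sub (Φ l)).hasDerivWithinAt

theorem injOn_sub (h : IsTimeChange Φ Φ' a b) {s l : ℝ} (hs : a ≤ s) (hl : l ≤ b) :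
    InjOn (fun ρ => Φ l - Φ ρ) (Ioo s l) := fun x hx y hy hxy =>
  h.strictMonoOn.injOn ⟨hs.trans hx.1.le, hx.2.le.trans hl⟩ ⟨hs.trans hy.1.le, hy.2.le.trans hl⟩
    (by simpa using! hxy)

theorem integral_deriv_mul_comp_sub (h : IsTimeChange Φ Φ' a b) {s l : ℝ} (hs : a ≤ s)
    (hsl : s ≤ l) (hl : l ≤ b) (g : ℝ → ℝ) :
    ∫ ρ in Ioo s l, Φ' ρ * g (Φ l - Φ ρ) = ∫ u in Ioo 0 (Φ l - Φ s), g u := by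
  rw [← h.image_Ioo hs hsl hl, integral_image_eq_integral_abs_deriv_smul measurableSet_Ioo
    (h.hasDerivWithinAt_sub hs hl) (h.injOn_sub hs hl)]
  refine setIntegral_congr_fun measurableSet_Ioo fun x hx => ?_
  have := h.deriv_pos x ⟨hs.trans hx.1.le, hx.2.le.trans hl⟩
  simp only [abs_neg, abs_of_pos this, smul_eq_mul]

theorem integrableOn_deriv_mul_comp_sub (h : IsTimeChange Φ Φ' a b) {s l : ℝ} (hs : a ≤ s)
    (hsl : s ≤ l) (hl : l ≤ b) {g : ℝ → ℝ} (hg : IntegrableOn g (Ioo 0 (Φ l - Φ s))) :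
    IntegrableOn (fun ρ => Φ' ρ * g (Φ l - Φ ρ)) (Ioo s l) := by
  rw [← h.image_Ioo hs hsl hl, integrableOn_image_iff_integrableOn_abs_deriv_smul measurableSet_Ioo
    (h.hasDerivWithinAt_sub hs hl) (h.injOn_sub hs hl)] at hg
  refine hg.congr_fun (fun x hx => ?_) measurableSet_Ioo
  have := h.deriv_pos x ⟨hs.trans hx.1.le, hx.2.le.trans hl⟩
  simp only [abs_neg, abs_of_pos this, smul_eq_mul]

theorem integrableOn_comp_sub_mul (h : IsTimeChange Φ Φ' a b) {l : ℝ} (hal : a ≤ l)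
    (hl : l ≤ b) {g f : ℝ → ℝ} (hg : ∀ T, IntegrableOn g (Ioo 0 T))
    (hf : ContinuousOn f (Icc a b)) :
    IntegrableOn (fun ρ => g (Φ l - Φ ρ) * f ρ) (Ioo a l) := by
  have hsub : Icc a l ⊆ Icc a b := Icc_subset_Icc_right hl
  have h1 := h.integrableOn_deriv_mul_comp_sub le_rfl hal hl (hg _)
  have h2 : ContinuousOn (fun ρ => f ρ / Φ' ρ) (Icc a l) :=
    (hf.div h.continuousOn_deriv fun x hx => (h.deriv_pos x hx).ne').mono hsub
  rw [← integrableOn_Icc_iff_integrableOn_Ioo] at h1 ⊢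
  refine (h1.mul_continuousOn h2 isCompact_Icc).congr_fun (fun x hx => ?_) measurableSet_Icc
  have := (h.deriv_pos x (hsub hx)).ne'
  field_simp

/-- Fubini's theorem for iterated Volterra integrals whose kernels convolve to `1`. -/
theorem integral_volterra_volterra (h : IsTimeChange Φ Φ' a b) {G k f : ℝ → ℝ}
    (hG : ∀ t > 0, 0 ≤ G t) (hGc : ContinuousOn G (Ioi 0))
    (hk : ∀ t > 0, 0 ≤ k t) (hkc : ContinuousOn k (Ioi 0))
    (hconv : ∀ t > 0, ∫ s in Ioo 0 t, G s * k (t - s) = 1)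
    (hf : ContinuousOn f (Icc a b)) {l : ℝ} (hal : a ≤ l) (hl : l ≤ b) :
    IntegrableOn (fun ρ => Φ' ρ * G (Φ l - Φ ρ) * ∫ s in Ioo a ρ, k (Φ ρ - Φ s) * f s)
        (Ioo a l) ∧
      ∫ ρ in Ioo a l, Φ' ρ * G (Φ l - Φ ρ) * ∫ s in Ioo a ρ, k (Φ ρ - Φ s) * f s =
        ∫ s in Ioo a l, f s := by
  set ν := volume.restrict (Ioo a l) with hν
  set A : Set (ℝ × ℝ) := {p | p.2 < p.1} with hA
  have hAm : MeasurableSet A := measurableSet_lt measurable_snd measurable_fst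
  set R : ℝ × ℝ → ℝ := fun p => Φ' p.1 * G (Φ l - Φ p.1) * (k (Φ p.1 - Φ p.2) * f p.2) with hR
  set H : ℝ × ℝ → ℝ := A.indicator R with hH
  have hsub : ∀ x ∈ Ioo a l, x ∈ Icc a b := fun x hx => ⟨hx.1.le, hx.2.le.trans hl⟩
  have hpos : ∀ x ∈ Ioo a l, 0 < Φ l - Φ x := fun x hx =>
    sub_pos.2 (h.strictMonoOn (hsub x hx) ⟨hal, hl⟩ hx.2)
  have hpos' : ∀ s ∈ Ioo a l, ∀ x ∈ Ioo a l, s < x → 0 < Φ x - Φ s := fun s hs x hx hsx =>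
    sub_pos.2 (h.strictMonoOn (hsub s hs) (hsub x hx) hsx)
  have hmeas : AEStronglyMeasurable H (ν.prod ν) := by
    rw [hH, aestronglyMeasurable_indicator_iff hAm, hν, Measure.prod_restrict,
      Measure.restrict_restrict hAm]
    refine ContinuousOn.aestronglyMeasurable ?_
      (hAm.inter (measurableSet_Ioo.prod measurableSet_Ioo))
    have m1 : MapsTo Prod.fst (A ∩ Ioo a l ×ˢ Ioo a l) (Icc a b) := fun p hp => hsub _ hp.2.1
    have m2 : MapsTo Prod.snd (A ∩ Ioo a l ×ˢ Ioo a l) (Icc a b) := fun p hp => hsub _ hp.2.2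
    have c1 := h.continuousOn.comp continuousOn_fst m1
    have c2 := h.continuousOn.comp continuousOn_snd m2
    exact ((h.continuousOn_deriv.comp continuousOn_fst m1).mul
      (hGc.comp (continuousOn_const.sub c1) fun p hp => hpos _ hp.2.1)).mul
      ((hkc.comp (c1.sub c2) fun p hp => hpos' _ hp.2.2 _ hp.2.1 hp.1).mul
        (hf.comp continuousOn_snd m2))
  have hcol : ∀ s ∈ Ioo a l,
      ∫ ρ in Ioo s l, Φ' ρ * G (Φ l - Φ ρ) * k (Φ ρ - Φ s) = 1 := by
    intro s hs
    have := h.integral_deriv_mul_comp_sub hs.1.le hs.2.le hl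
      (fun u => G u * k (Φ l - Φ s - u))
    rw [hconv _ (hpos s hs)] at this
    rw [← this]
    refine setIntegral_congr_fun measurableSet_Ioo fun ρ _ => ?_
    simp only [sub_sub_sub_cancel_left]
    ring
  have hslice : ∀ s, (fun ρ => H (ρ, s)) =
      (Ioi s).indicator fun ρ => Φ' ρ * G (Φ l - Φ ρ) * k (Φ ρ - Φ s) * f s := by
    intro s
    funext ρ
    by_cases hsρ : s < ρ
    · simp [hH, hA, hR, hsρ, mul_assoc]
    · simp [hH, hA, hsρ]
  have hinter : ∀ s ∈ Ioo a l, Ioo a l ∩ Ioi s = Ioo s l := by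
    intro s hs
    rw [Ioo_inter_Ioi, max_eq_right hs.1.le]
  have hnonneg : ∀ s ∈ Ioo a l, ∀ ρ ∈ Ioo s l, 0 ≤ Φ' ρ * G (Φ l - Φ ρ) * k (Φ ρ - Φ s) := by
    intro s hs ρ hρ
    have hρ' : ρ ∈ Ioo a l := ⟨hs.1.trans hρ.1, hρ.2⟩
    exact mul_nonneg (mul_nonneg (h.deriv_pos ρ (hsub ρ hρ')).le (hG _ (hpos ρ hρ')))
      (hk _ (hpos' s hs ρ hρ' hρ.1))
  have hcolint : ∀ s ∈ Ioo a l, ∫ ρ in Ioo a l, H (ρ, s) = f s := by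
    intro s hs
    rw [hslice s, setIntegral_indicator measurableSet_Ioi, hinter s hs, integral_mul_const,
      hcol s hs, one_mul]
  have hcolnorm : ∀ s ∈ Ioo a l, ∫ ρ in Ioo a l, ‖H (ρ, s)‖ = |f s| := by
    intro s hs
    have : (fun ρ => ‖H (ρ, s)‖) =
        (Ioi s).indicator fun ρ => ‖Φ' ρ * G (Φ l - Φ ρ) * k (Φ ρ - Φ s) * f s‖ := by
      funext ρ
      rw [← norm_indicator_eq_indicator_norm, ← congrFun (hslice s) ρ]
    rw [this, setIntegral_indicator measurableSet_Ioi, hinter s hs, ← one_mul |f s|, ← hcol s hs,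
      ← integral_mul_const]
    refine setIntegral_congr_fun measurableSet_Ioo fun ρ hρ => ?_
    rw [norm_mul, norm_of_nonneg (hnonneg s hs ρ hρ), norm_eq_abs]
  have hfi : IntegrableOn f (Ioo a l) :=
    (hf.integrableOn_Icc).mono_set fun x hx => hsub x hx
  have hint : Integrable H (ν.prod ν) := by
    rw [integrable_prod_iff' hmeas]
    constructor
    · filter_upwards [ae_restrict_mem measurableSet_Ioo] with s hs
      rw [hslice s, hν, integrable_indicator_iff measurableSet_Ioi, IntegrableOn,
        Measure.restrict_restrict measurableSet_Ioi, inter_comm, hinter s hs]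
      exact (Integrable.of_integral_ne_zero (by rw [hcol s hs]; exact one_ne_zero)).mul_const _
    · exact Integrable.congr hfi.norm
        ((ae_restrict_mem measurableSet_Ioo).mono fun s hs => (hcolnorm s hs).symm)
  have hrow : ∀ ρ ∈ Ioo a l, ∫ s in Ioo a l, H (ρ, s) =
      Φ' ρ * G (Φ l - Φ ρ) * ∫ s in Ioo a ρ, k (Φ ρ - Φ s) * f s := by
    intro ρ hρ
    have : (fun s => H (ρ, s)) = (Iio ρ).indicator fun s => R (ρ, s) := by
      funext s
      by_cases hsρ : s < ρ
      · simp [hH, hA, hsρ]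
      · simp [hH, hA, hsρ]
    rw [this, setIntegral_indicator measurableSet_Iio, Ioo_inter_Iio, min_eq_right hρ.2.le,
      ← integral_const_mul]
  constructor
  · exact (hint.integral_prod_left).congr
      ((ae_restrict_mem measurableSet_Ioo).mono fun ρ hρ => hrow ρ hρ)
  · rw [← setIntegral_congr_fun measurableSet_Ioo fun ρ hρ => hrow ρ hρ,
      integral_integral_swap (f := fun ρ s => H (ρ, s)) hint]
    exact setIntegral_congr_fun measurableSet_Ioo fun s hs => hcolint s hs

end IsTimeChange

/-- Scheffé's lemma. -/
theorem tendsto_integral_abs_sub_of_tendsto_integral {α ι : Type*} [MeasurableSpace α]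
    {ν : Measure α} {l : Filter ι} [l.IsCountablyGenerated] {f : ι → α → ℝ} {g : α → ℝ}
    (hf : ∀ᶠ i in l, Integrable (f i) ν) (hg : Integrable g ν)
    (hf0 : ∀ᶠ i in l, ∀ᵐ x ∂ν, 0 ≤ f i x) (hg0 : ∀ᵐ x ∂ν, 0 ≤ g x)
    (hfg : ∀ᵐ x ∂ν, Filter.Tendsto (fun i => f i x) l (nhds (g x)))
    (hint : Filter.Tendsto (fun i => ∫ x, f i x ∂ν) l (nhds (∫ x, g x ∂ν))) :
    Filter.Tendsto (fun i => ∫ x, |f i x - g x| ∂ν) l (nhds 0) := by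
  have hmin : Filter.Tendsto (fun i => ∫ x, min (f i x) (g x) ∂ν) l (nhds (∫ x, g x ∂ν)) := by
    refine tendsto_integral_filter_of_dominated_convergence g ?_ ?_ hg ?_
    · filter_upwards [hf] with i hi using (hi.inf hg).aestronglyMeasurable
    · filter_upwards [hf0] with i hi
      filter_upwards [hi, hg0] with x hx hx'
      rw [norm_of_nonneg (le_min hx hx')]
      exact min_le_right _ _
    · filter_upwards [hfg] with x hx
      simpa using hx.min (tendsto_const_nhds (x := g x))
  have h := (hint.add_const (∫ x, g x ∂ν)).sub (hmin.const_mul 2)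
  rw [show ∫ x, g x ∂ν + ∫ x, g x ∂ν - 2 * ∫ x, g x ∂ν = 0 by ring] at h
  refine h.congr' ?_
  filter_upwards [hf] with i hi
  have hmi : Integrable (fun x => 2 * min (f i x) (g x)) ν := (hi.inf hg).const_mul 2
  have hadd : Integrable (fun x => f i x + g x) ν := hi.add hg
  rw [← integral_add hi hg, ← integral_const_mul, ← integral_sub hadd hmi]
  refine integral_congr_ae (Filter.Eventually.of_forall fun x => ?_)
  simp only
  rcases le_total (f i x) (g x) with hx | hx
  · rw [min_eq_left hx, abs_of_nonpos (sub_nonpos.2 hx)]; ring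
  · rw [min_eq_right hx, abs_of_nonneg (sub_nonneg.2 hx)]; ring

/-- A nonnegative kernel on `a < ρ < ℓ ≤ b`, integrable in `ρ`, whose Volterra operator
`f ↦ ∫ₐˡ W(ℓ, ρ) f(ρ) dρ` maps bounded measurable functions to continuous ones. -/
structure IsVolterraKernel (W : ℝ → ℝ → ℝ) (a b : ℝ) : Prop where
  nonneg : ∀ l ∈ Icc a b, ∀ ρ ∈ Ioo a l, 0 ≤ W l ρ
  integrableOn : ∀ l ∈ Icc a b, IntegrableOn (W l) (Ioo a l)
  continuousOn_integral : ∀ (f : ℝ → ℝ) (M : ℝ),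
    AEStronglyMeasurable f (volume.restrict (Ioo a b)) → (∀ ρ ∈ Ioo a b, |f ρ| ≤ M) →
    ContinuousOn (fun l => ∫ ρ in Ioo a l, W l ρ * f ρ) (Icc a b)

theorem IsTimeChange.isVolterraKernel {Φ Φ' G : ℝ → ℝ} {a b : ℝ} (h : IsTimeChange Φ Φ' a b)
    (hG : ∀ t > 0, 0 ≤ G t) (hGc : ContinuousOn G (Ioi 0))
    (hGi : ∀ T, IntegrableOn G (Ioo 0 T)) :
    IsVolterraKernel (fun l ρ => Φ' ρ * G (Φ l - Φ ρ)) a b := by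
  have hpos : ∀ l ∈ Icc a b, ∀ ρ ∈ Ioo a l, 0 < Φ l - Φ ρ := fun l hl ρ hρ =>
    sub_pos.2 (h.strictMonoOn ⟨hρ.1.le, hρ.2.le.trans hl.2⟩ hl hρ.2)
  have hnonneg : ∀ l ∈ Icc a b, ∀ ρ ∈ Ioo a l, 0 ≤ Φ' ρ * G (Φ l - Φ ρ) := fun l hl ρ hρ =>
    mul_nonneg (h.deriv_pos _ ⟨hρ.1.le, hρ.2.le.trans hl.2⟩).le (hG _ (hpos l hl ρ hρ))
  have hint : ∀ l ∈ Icc a b, IntegrableOn (fun ρ => Φ' ρ * G (Φ l - Φ ρ)) (Ioo a l) :=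
    fun l hl => h.integrableOn_deriv_mul_comp_sub le_rfl hl.1 hl.2 (hGi _)
  refine ⟨hnonneg, hint, fun f M hf hM l₀ hl₀ => ?_⟩
  set ν := volume.restrict (Ioo a b) with hν
  set K : ℝ → ℝ → ℝ := fun l => (Iio l).indicator fun ρ => Φ' ρ * G (Φ l - Φ ρ) with hK
  have hinter : ∀ l ∈ Icc a b, Ioo a b ∩ Iio l = Ioo a l := fun l hl => by
    rw [Ioo_inter_Iio, min_eq_right hl.2]
  have hKint : ∀ l ∈ Icc a b, Integrable (K l) ν := fun l hl => by
    rw [hν, hK, integrable_indicator_iff measurableSet_Iio, IntegrableOn,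
      Measure.restrict_restrict measurableSet_Iio, inter_comm, hinter l hl]
    exact hint l hl
  have hK0 : ∀ l ∈ Icc a b, ∀ᵐ ρ ∂ν, 0 ≤ K l ρ := fun l hl => by
    filter_upwards [ae_restrict_mem measurableSet_Ioo] with ρ hρ
    by_cases hρl : ρ < l
    · simpa [hK, hρl] using! hnonneg l hl ρ ⟨hρ.1, hρl⟩
    · simp [hK, hρl]
  have hKf : ∀ l ∈ Icc a b, ∫ ρ in Ioo a l, Φ' ρ * G (Φ l - Φ ρ) * f ρ = ∫ ρ, K l ρ * f ρ ∂ν := by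
    intro l hl
    rw [hν, ← hinter l hl, ← setIntegral_indicator measurableSet_Iio]
    refine integral_congr_ae (Filter.Eventually.of_forall fun ρ => ?_)
    simp only [hK, indicator_mul_left]
  have hKtot : ∀ l ∈ Icc a b, ∫ ρ, K l ρ ∂ν = ∫ u in Ioo 0 (Φ l - Φ a), G u := by
    intro l hl
    rw [hν, hK, setIntegral_indicator measurableSet_Iio, hinter l hl,
      h.integral_deriv_mul_comp_sub le_rfl hl.1 hl.2]
  have hΦ : Filter.Tendsto Φ (nhdsWithin l₀ (Icc a b)) (nhds (Φ l₀)) := h.continuousOn l₀ hl₀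
  have hmem : ∀ᶠ l in nhdsWithin l₀ (Icc a b), l ∈ Icc a b := self_mem_nhdsWithin
  have hab : a ≤ b := hl₀.1.trans hl₀.2
  have hsch : Filter.Tendsto (fun l => ∫ ρ, |K l ρ - K l₀ ρ| ∂ν) (nhdsWithin l₀ (Icc a b))
      (nhds 0) := by
    refine tendsto_integral_abs_sub_of_tendsto_integral (hmem.mono hKint) (hKint l₀ hl₀)
      (hmem.mono hK0) (hK0 l₀ hl₀) ?_ ?_
    · filter_upwards [ae_restrict_mem measurableSet_Ioo,
        Measure.ae_ne (μ := ν) l₀] with ρ hρ hne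
      rcases lt_or_gt_of_ne hne with hlt | hgt
      · have hG' : ContinuousAt G (Φ l₀ - Φ ρ) :=
          hGc.continuousAt (Ioi_mem_nhds (hpos l₀ hl₀ ρ ⟨hρ.1, hlt⟩))
        have h1 : Filter.Tendsto (fun l => Φ' ρ * G (Φ l - Φ ρ)) (nhdsWithin l₀ (Icc a b))
            (nhds (Φ' ρ * G (Φ l₀ - Φ ρ))) := (hG'.tendsto.comp (hΦ.sub_const _)).const_mul _
        have h2 : K l₀ ρ = Φ' ρ * G (Φ l₀ - Φ ρ) := by simp [hK, hlt]
        rw [h2]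
        refine h1.congr' ?_
        filter_upwards [mem_nhdsWithin_of_mem_nhds (Ioi_mem_nhds hlt)] with l hl
        have : ρ < l := hl
        simp [hK, this]
      · have h2 : K l₀ ρ = 0 := by simp [hK, hgt.not_gt]
        rw [h2]
        refine tendsto_const_nhds.congr' ?_
        filter_upwards [mem_nhdsWithin_of_mem_nhds (Iio_mem_nhds hgt)] with l hl
        have : l < ρ := hl
        simp [hK, this.not_gt]
    · rw [hKtot l₀ hl₀]
      have hmono : ∀ l ∈ Icc a b, Φ l - Φ a ∈ Ici (0 : ℝ) := fun l hl =>
        sub_nonneg.2 (h.strictMonoOn.monotoneOn ⟨le_rfl, hab⟩ hl hl.1)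
      have hc : ContinuousOn (fun l => ∫ u in Ioo 0 (Φ l - Φ a), G u) (Icc a b) :=
        (continuousOn_integral_Ioo hGi).comp (h.continuousOn.sub continuousOn_const) hmono
      exact (hc l₀ hl₀).tendsto.congr' (hmem.mono fun l hl => (hKtot l hl).symm)
  have hKfint : ∀ l ∈ Icc a b, Integrable (fun ρ => K l ρ * f ρ) ν := fun l hl =>
    (hKint l hl).mul_bdd (c := M) hf ((ae_restrict_mem measurableSet_Ioo).mono fun ρ hρ => hM ρ hρ)
  rw [ContinuousWithinAt, tendsto_iff_norm_sub_tendsto_zero]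
  refine squeeze_zero' (Filter.Eventually.of_forall fun l => norm_nonneg _) ?_
    (by simpa using hsch.const_mul M)
  filter_upwards [hmem] with l hl
  rw [hKf l hl, hKf l₀ hl₀, ← integral_sub (hKfint l hl) (hKfint l₀ hl₀), ← integral_const_mul]
  refine norm_integral_le_of_norm_le (((hKint l hl).sub (hKint l₀ hl₀)).abs.const_mul M) ?_
  filter_upwards [ae_restrict_mem measurableSet_Ioo] with ρ hρ
  rw [← sub_mul, norm_mul, norm_eq_abs, norm_eq_abs, mul_comm]
  exact mul_le_mul_of_nonneg_right (hM ρ hρ) (abs_nonneg _)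

namespace IsVolterraKernel

variable {W : ℝ → ℝ → ℝ} {a b : ℝ}

theorem integrableOn_mul (h : IsVolterraKernel W a b) {f : ℝ → ℝ} (hf : ContinuousOn f (Icc a b))
    {l : ℝ} (hl : l ∈ Icc a b) : IntegrableOn (fun ρ => W l ρ * f ρ) (Ioo a l) := by
  have h1 := h.integrableOn l hl
  rw [← integrableOn_Icc_iff_integrableOn_Ioo] at h1 ⊢
  exact h1.mul_continuousOn (hf.mono (Icc_subset_Icc_right hl.2)) isCompact_Icc

theorem integral_mul_mono (h : IsVolterraKernel W a b) {f g : ℝ → ℝ}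
    (hf : ContinuousOn f (Icc a b)) (hg : ContinuousOn g (Icc a b))
    (hfg : ∀ ρ ∈ Icc a b, f ρ ≤ g ρ) {l : ℝ} (hl : l ∈ Icc a b) :
    ∫ ρ in Ioo a l, W l ρ * f ρ ≤ ∫ ρ in Ioo a l, W l ρ * g ρ :=
  setIntegral_mono_on (h.integrableOn_mul hf hl) (h.integrableOn_mul hg hl) measurableSet_Ioo
    fun ρ hρ => mul_le_mul_of_nonneg_left (hfg ρ ⟨hρ.1.le, hρ.2.le.trans hl.2⟩)
      (h.nonneg l hl ρ hρ)

/-- Monotone iteration started at a subsolution `u` converges to the least solution between the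
subsolution `u` and the supersolution `v`. -/
theorem exists_least_solution (h : IsVolterraKernel W a b) {F : ℝ → ℝ → ℝ} {u v : ℝ → ℝ} {c : ℝ}
    (hF : ContinuousOn (fun p : ℝ × ℝ => F p.1 p.2) (Icc a b ×ˢ univ))
    (hu : ContinuousOn u (Icc a b)) (hv : ContinuousOn v (Icc a b))
    (huv : ∀ l ∈ Icc a b, u l ≤ v l)
    (hFmono : ∀ l ∈ Icc a b, ∀ x y, u l ≤ x → x ≤ y → y ≤ v l → F l x ≤ F l y)
    (husub : ∀ l ∈ Icc a b, u l ≤ c + ∫ ρ in Ioo a l, W l ρ * F ρ (u ρ))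
    (hvsup : ∀ l ∈ Icc a b, c + ∫ ρ in Ioo a l, W l ρ * F ρ (v ρ) ≤ v l) :
    ∃ z : ℝ → ℝ, ContinuousOn z (Icc a b) ∧ (∀ l ∈ Icc a b, u l ≤ z l ∧ z l ≤ v l) ∧
      (∀ l ∈ Icc a b, z l = c + ∫ ρ in Ioo a l, W l ρ * F ρ (z ρ)) ∧
      ∀ w : ℝ → ℝ, ContinuousOn w (Icc a b) → (∀ l ∈ Icc a b, u l ≤ w l ∧ w l ≤ v l) →
        (∀ l ∈ Icc a b, w l = c + ∫ ρ in Ioo a l, W l ρ * F ρ (w ρ)) →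
        ∀ l ∈ Icc a b, z l ≤ w l := by
  have hFc : ∀ x : ℝ → ℝ, ContinuousOn x (Icc a b) →
      ContinuousOn (fun ρ => F ρ (x ρ)) (Icc a b) := fun x hx =>
    hF.comp (continuousOn_id.prodMk hx) fun ρ hρ => ⟨hρ, mem_univ _⟩
  obtain ⟨M₁, hM₁⟩ := isCompact_Icc.exists_bound_of_continuousOn (hFc u hu)
  obtain ⟨M₂, hM₂⟩ := isCompact_Icc.exists_bound_of_continuousOn (hFc v hv)
  have hbound : ∀ ρ ∈ Icc a b, ∀ x, u ρ ≤ x → x ≤ v ρ → |F ρ x| ≤ M₁ + M₂ := by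
    intro ρ hρ x hx hx'
    have h1 := abs_le.1 (hM₁ ρ hρ)
    have h2 := abs_le.1 (hM₂ ρ hρ)
    have h3 := hFmono ρ hρ (u ρ) x le_rfl hx hx'
    have h4 := hFmono ρ hρ x (v ρ) hx hx' le_rfl
    rw [abs_le]
    constructor <;> linarith
  set T : (ℝ → ℝ) → ℝ → ℝ := fun x l => c + ∫ ρ in Ioo a l, W l ρ * F ρ (x ρ) with hT
  have hTc : ∀ x, ContinuousOn x (Icc a b) → (∀ l ∈ Icc a b, u l ≤ x l ∧ x l ≤ v l) →
      ContinuousOn (T x) (Icc a b) := fun x hx hxs =>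
    continuousOn_const.add (h.continuousOn_integral _ (M₁ + M₂)
      (((hFc x hx).mono Ioo_subset_Icc_self).aestronglyMeasurable measurableSet_Ioo)
      fun ρ hρ => hbound ρ (Ioo_subset_Icc_self hρ) _ (hxs ρ (Ioo_subset_Icc_self hρ)).1
        (hxs ρ (Ioo_subset_Icc_self hρ)).2)
  have hTmono : ∀ x y, ContinuousOn x (Icc a b) → ContinuousOn y (Icc a b) →
      (∀ l ∈ Icc a b, u l ≤ x l) → (∀ l ∈ Icc a b, x l ≤ y l) → (∀ l ∈ Icc a b, y l ≤ v l) →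
      ∀ l ∈ Icc a b, T x l ≤ T y l := fun x y hx hy hux hxy hyv l hl =>
    add_le_add_right (h.integral_mul_mono (hFc x hx) (hFc y hy)
      (fun ρ hρ => hFmono ρ hρ _ _ (hux ρ hρ) (hxy ρ hρ) (hyv ρ hρ)) hl) c
  set z : ℕ → ℝ → ℝ := fun n => T^[n] u with hz
  have hz0 : z 0 = u := rfl
  have hzs : ∀ n, z (n + 1) = T (z n) := fun n => Function.iterate_succ_apply' T n u
  have hinv : ∀ n, ContinuousOn (z n) (Icc a b) ∧
      ∀ l ∈ Icc a b, u l ≤ z n l ∧ z n l ≤ v l ∧ z n l ≤ T (z n) l := by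
    intro n
    induction n with
    | zero => exact ⟨hu, fun l hl => ⟨le_rfl, huv l hl, husub l hl⟩⟩
    | succ n ih =>
      obtain ⟨hc, hs⟩ := ih
      have hc' : ContinuousOn (T (z n)) (Icc a b) :=
        hTc _ hc fun l hl => ⟨(hs l hl).1, (hs l hl).2.1⟩
      have hTv : ∀ l ∈ Icc a b, T (z n) l ≤ v l := fun l hl =>
        (hTmono _ _ hc hv (fun l hl => (hs l hl).1) (fun l hl => (hs l hl).2.1)
          (fun _ _ => le_rfl) l hl).trans (hvsup l hl)
      rw [hzs]
      exact ⟨hc', fun l hl => ⟨(hs l hl).1.trans (hs l hl).2.2, hTv l hl,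
        hTmono _ _ hc hc' (fun l hl => (hs l hl).1) (fun l hl => (hs l hl).2.2) hTv l hl⟩⟩
  have hmono : ∀ l ∈ Icc a b, Monotone fun n => z n l := fun l hl =>
    monotone_nat_of_le_succ fun n => by
      rw [hzs]
      exact ((hinv n).2 l hl).2.2
  set zs : ℝ → ℝ := fun l => ⨆ n, z n l with hzsup
  have hlim : ∀ l ∈ Icc a b, Filter.Tendsto (fun n => z n l) Filter.atTop (nhds (zs l)) :=
    fun l hl => tendsto_atTop_ciSup (hmono l hl)
      ⟨v l, by rintro _ ⟨n, rfl⟩; exact ((hinv n).2 l hl).2.1⟩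
  have hsec : ∀ l ∈ Icc a b, u l ≤ zs l ∧ zs l ≤ v l := fun l hl =>
    ⟨ge_of_tendsto' (hlim l hl) fun n => ((hinv n).2 l hl).1,
      le_of_tendsto' (hlim l hl) fun n => ((hinv n).2 l hl).2.1⟩
  have hFlim : ∀ ρ ∈ Icc a b,
      Filter.Tendsto (fun n => F ρ (z n ρ)) Filter.atTop (nhds (F ρ (zs ρ))) := by
    intro ρ hρ
    have hc : Continuous (F ρ) := continuousOn_univ.1
      (hF.comp (continuousOn_const.prodMk continuousOn_id) fun x _ => ⟨hρ, mem_univ _⟩)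
    exact (hc.tendsto _).comp (hlim ρ hρ)
  have hfix : ∀ l ∈ Icc a b, zs l = T zs l := by
    intro l hl
    refine tendsto_nhds_unique ((Filter.tendsto_add_atTop_iff_nat 1).2 (hlim l hl)) ?_
    have hmem : ∀ ρ ∈ Ioo a l, ρ ∈ Icc a b := fun ρ hρ => ⟨hρ.1.le, hρ.2.le.trans hl.2⟩
    simp_rw [hzs]
    refine Filter.Tendsto.const_add c (tendsto_integral_of_dominated_convergence
      (fun ρ => W l ρ * (M₁ + M₂)) (fun n => ?_) ((h.integrableOn l hl).mul_const _)
      (fun n => ?_) ?_)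
    · exact (h.integrableOn_mul (hFc _ (hinv n).1) hl).aestronglyMeasurable
    · filter_upwards [ae_restrict_mem measurableSet_Ioo] with ρ hρ
      rw [norm_mul, norm_of_nonneg (h.nonneg l hl ρ hρ)]
      exact mul_le_mul_of_nonneg_left (hbound ρ (hmem ρ hρ) _ ((hinv n).2 ρ (hmem ρ hρ)).1
        ((hinv n).2 ρ (hmem ρ hρ)).2.1) (h.nonneg l hl ρ hρ)
    · filter_upwards [ae_restrict_mem measurableSet_Ioo] with ρ hρ
      exact (hFlim ρ (hmem ρ hρ)).const_mul _
  have hcont : ContinuousOn zs (Icc a b) := by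
    refine ContinuousOn.congr ?_ hfix
    refine continuousOn_const.add (h.continuousOn_integral _ (M₁ + M₂) ?_ fun ρ hρ =>
      hbound ρ (Ioo_subset_Icc_self hρ) _ (hsec ρ (Ioo_subset_Icc_self hρ)).1
        (hsec ρ (Ioo_subset_Icc_self hρ)).2)
    refine aestronglyMeasurable_of_tendsto_ae Filter.atTop (f := fun n ρ => F ρ (z n ρ))
      (fun n => ((hFc _ (hinv n).1).mono Ioo_subset_Icc_self).aestronglyMeasurable
        measurableSet_Ioo) ?_
    filter_upwards [ae_restrict_mem measurableSet_Ioo] with ρ hρ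
    exact hFlim ρ (Ioo_subset_Icc_self hρ)
  refine ⟨zs, hcont, hsec, hfix, fun w hw hws hwT l hl => ?_⟩
  have hle : ∀ n, ∀ l ∈ Icc a b, z n l ≤ w l := by
    intro n
    induction n with
    | zero => exact fun l hl => (hws l hl).1
    | succ n ih =>
      intro l hl
      rw [hzs, hwT l hl]
      exact hTmono _ _ (hinv n).1 hw (fun l hl => ((hinv n).2 l hl).1) ih
        (fun l hl => (hws l hl).2) l hl
  exact le_of_tendsto' (hlim l hl) fun n => hle n l hl

/-- The counterpart of `exists_least_solution` for the greatest solution. -/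
theorem exists_greatest_solution (h : IsVolterraKernel W a b) {F : ℝ → ℝ → ℝ} {u v : ℝ → ℝ}
    {c : ℝ} (hF : ContinuousOn (fun p : ℝ × ℝ => F p.1 p.2) (Icc a b ×ˢ univ))
    (hu : ContinuousOn u (Icc a b)) (hv : ContinuousOn v (Icc a b))
    (huv : ∀ l ∈ Icc a b, u l ≤ v l)
    (hFmono : ∀ l ∈ Icc a b, ∀ x y, u l ≤ x → x ≤ y → y ≤ v l → F l x ≤ F l y)
    (husub : ∀ l ∈ Icc a b, u l ≤ c + ∫ ρ in Ioo a l, W l ρ * F ρ (u ρ))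
    (hvsup : ∀ l ∈ Icc a b, c + ∫ ρ in Ioo a l, W l ρ * F ρ (v ρ) ≤ v l) :
    ∃ z : ℝ → ℝ, ContinuousOn z (Icc a b) ∧ (∀ l ∈ Icc a b, u l ≤ z l ∧ z l ≤ v l) ∧
      (∀ l ∈ Icc a b, z l = c + ∫ ρ in Ioo a l, W l ρ * F ρ (z ρ)) ∧
      ∀ w : ℝ → ℝ, ContinuousOn w (Icc a b) → (∀ l ∈ Icc a b, u l ≤ w l ∧ w l ≤ v l) →
        (∀ l ∈ Icc a b, w l = c + ∫ ρ in Ioo a l, W l ρ * F ρ (w ρ)) →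
        ∀ l ∈ Icc a b, w l ≤ z l := by
  have hneg : ∀ (x : ℝ → ℝ) (l : ℝ), -c + ∫ ρ in Ioo a l, W l ρ * -F ρ (-x ρ) =
      -(c + ∫ ρ in Ioo a l, W l ρ * F ρ (-x ρ)) := fun x l => by
    simp_rw [mul_neg, integral_neg]
    ring
  obtain ⟨z, hz, hzs, hzT, hzl⟩ := h.exists_least_solution (F := fun l x => -F l (-x))
    (u := fun l => -v l) (v := fun l => -u l) (c := -c)
    (hF.comp (f := fun p : ℝ × ℝ => (p.1, -p.2)) (by fun_prop)
      fun p hp => ⟨hp.1, mem_univ _⟩).neg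
    hv.neg hu.neg (fun l hl => neg_le_neg (huv l hl))
    (fun l hl x y hx hxy hy => neg_le_neg (hFmono l hl _ _ (by linarith) (by linarith)
      (by linarith)))
    (fun l hl => by rw [hneg]; simpa using! hvsup l hl)
    (fun l hl => by rw [hneg]; simpa using! husub l hl)
  refine ⟨fun l => -z l, hz.neg, fun l hl => ?_, fun l hl => ?_, fun w hw hws hwT l hl => ?_⟩
  · constructor <;> linarith [(hzs l hl).1, (hzs l hl).2]
  · simp only
    rw [hzT l hl, hneg, neg_neg]
  · have := hzl (fun l => -w l) hw.neg
      (fun l hl => ⟨neg_le_neg (hws l hl).2, neg_le_neg (hws l hl).1⟩)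
      (fun l hl => by
        rw [hneg]
        simp only [neg_neg]
        rw [← hwT l hl]) l hl
    linarith

end IsVolterraKernel

theorem IsTimeChange.caputo_eq_integral_caputoKernel {Φ Φ' : ℝ → ℝ} {a b μ κ ω : ℝ}
    (h : IsTimeChange Φ Φ' a b) (hκμ : κ < μ) (hμ1 : μ < 1) {f : ℝ → ℝ}
    (hf : ContinuousOn f (Icc a b)) {l : ℝ} (hl : l ∈ Icc a b) :
    (1 / Real.Gamma (1 - μ)) * (∫ ρ in a..l, (Φ l - Φ ρ) ^ (-μ) * f ρ)
        + ω * ((1 / Real.Gamma (1 - κ)) * ∫ ρ in a..l, (Φ l - Φ ρ) ^ (-κ) * f ρ) =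
      ∫ ρ in Ioo a l, caputoKernel μ κ ω (Φ l - Φ ρ) * f ρ := by
  have hpow : ∀ r : ℝ, r < 1 →
      IntegrableOn (fun ρ => (Φ l - Φ ρ) ^ (-r) * f ρ) (Ioo a l) := by
    refine fun r hr => h.integrableOn_comp_sub_mul (g := fun t => t ^ (-r)) hl.1 hl.2
      (fun T => ?_) hf
    rcases le_or_gt T 0 with hT | hT
    · simp [Ioo_eq_empty hT.not_gt]
    · exact (intervalIntegral.integrableOn_Ioo_rpow_iff hT).2 (by linarith)
  simp_rw [intervalIntegral.integral_of_le hl.1, integral_Ioc_eq_integral_Ioo,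
    ← integral_const_mul]
  rw [← integral_add ((hpow μ hμ1).const_mul _)
    (((hpow κ (hκμ.trans hμ1)).const_mul _).const_mul _)]
  refine setIntegral_congr_fun measurableSet_Ioo fun ρ _ => ?_
  simp only [caputoKernel]
  ring

/-- Convolving the two-term Caputo operator of `z` with the solution kernel recovers
`z - z(a)`. -/
theorem IsTimeChange.integral_solutionKernel_mul_caputo {Φ Φ' : ℝ → ℝ} {a b μ κ ω : ℝ}
    (h : IsTimeChange Φ Φ' a b) (hκ0 : 0 < κ) (hκμ : κ < μ) (hμ1 : μ < 1) (hω : 0 < ω)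
    {z z' : ℝ → ℝ} (hz : ∀ x ∈ Icc a b, HasDerivAt z (z' x) x)
    (hz' : ContinuousOn z' (Icc a b)) {l : ℝ} (hl : l ∈ Icc a b) :
    IntegrableOn (fun ρ => Φ' ρ * solutionKernel μ κ ω (Φ l - Φ ρ) *
        ∫ s in Ioo a ρ, caputoKernel μ κ ω (Φ ρ - Φ s) * z' s) (Ioo a l) ∧
      ∫ ρ in Ioo a l, Φ' ρ * solutionKernel μ κ ω (Φ l - Φ ρ) *
        ∫ s in Ioo a ρ, caputoKernel μ κ ω (Φ ρ - Φ s) * z' s = z l - z a := by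
  have hsub : Icc a l ⊆ Icc a b := Icc_subset_Icc_right hl.2
  have hFub := h.integral_volterra_volterra (G := solutionKernel μ κ ω)
    (fun t ht => (solutionKernel_pos hκ0 hκμ hμ1 hω ht).le)
    (fun t ht => (differentiableAt_solutionKernel hκ0 hκμ ht).continuousAt.continuousWithinAt)
    (fun t ht => caputoKernel_nonneg hκμ hμ1 hω ht) continuousOn_caputoKernel
    (fun t ht => integral_solutionKernel_mul_caputoKernel hκ0 hκμ hμ1 ht) hz' hl.1 hl.2
  refine ⟨hFub.1, hFub.2.trans ?_⟩
  rw [← integral_Ioc_eq_integral_Ioo, ← intervalIntegral.integral_of_le hl.1]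
  refine intervalIntegral.integral_eq_sub_of_hasDerivAt (fun x hx => hz x ?_) ?_
  · rw [uIcc_of_le hl.1] at hx
    exact hsub hx
  · refine ContinuousOn.intervalIntegrable ?_
    rw [uIcc_of_le hl.1]
    exact hz'.mono hsub

/-- Existence of extremal solutions: under the lower/upper solution
hypotheses and monotonicity of `F` in the sector, there exist extremal continuous
solutions `z*`, `z̃*` of the integral equation in the sector `[z₀, z̃₀]`. -/
theorem extremal_solutions_exist
    (a b : ℝ) (hab : a < b)
    (Φ Φ' : ℝ → ℝ)
    (hΦd : ∀ x ∈ Icc a b, HasDerivAt Φ (Φ' x) x)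
    (hΦ'c : ContinuousOn Φ' (Icc a b))
    (hΦ'pos : ∀ x ∈ Icc a b, 0 < Φ' x)
    (μ κ ω za : ℝ) (hκ0 : 0 < κ) (hκμ : κ < μ) (hμ1 : μ < 1) (hω : 0 < ω)
    (F : ℝ → ℝ → ℝ)
    (hFc : ContinuousOn (fun p : ℝ × ℝ => F p.1 p.2) (Icc a b ×ˢ (univ : Set ℝ)))
    -- z₀ is a lower solution:
    (z₀ z₀' : ℝ → ℝ)
    (hz₀d : ∀ x ∈ Icc a b, HasDerivAt z₀ (z₀' x) x)
    (hz₀'c : ContinuousOn z₀' (Icc a b))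
    (hlow : ∀ ℓ ∈ Icc a b,
      (1 / Real.Gamma (1 - μ)) * (∫ ρ in a..ℓ, (Φ ℓ - Φ ρ) ^ (-μ) * z₀' ρ)
        + ω * ((1 / Real.Gamma (1 - κ)) * ∫ ρ in a..ℓ, (Φ ℓ - Φ ρ) ^ (-κ) * z₀' ρ)
      ≤ F ℓ (z₀ ℓ))
    (hlowa : z₀ a ≤ za)
    -- z̃₀ is an upper solution:
    (zt₀ zt₀' : ℝ → ℝ)
    (hzt₀d : ∀ x ∈ Icc a b, HasDerivAt zt₀ (zt₀' x) x)
    (hzt₀'c : ContinuousOn zt₀' (Icc a b))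
    (hup : ∀ ℓ ∈ Icc a b,
      F ℓ (zt₀ ℓ) ≤
        (1 / Real.Gamma (1 - μ)) * (∫ ρ in a..ℓ, (Φ ℓ - Φ ρ) ^ (-μ) * zt₀' ρ)
          + ω * ((1 / Real.Gamma (1 - κ)) * ∫ ρ in a..ℓ, (Φ ℓ - Φ ρ) ^ (-κ) * zt₀' ρ))
    (hupa : za ≤ zt₀ a)
    -- ordering of lower and upper solutions and monotonicity of F in the sector:
    (hord : ∀ ℓ ∈ Icc a b, z₀ ℓ ≤ zt₀ ℓ)
    (hFmono : ∀ ℓ ∈ Icc a b, ∀ x y : ℝ,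
      z₀ ℓ ≤ x → x ≤ y → y ≤ zt₀ ℓ → F ℓ x ≤ F ℓ y) :
    ∃ zs zts : ℝ → ℝ,
      ContinuousOn zs (Icc a b) ∧ ContinuousOn zts (Icc a b) ∧
      (∀ ℓ ∈ Icc a b, z₀ ℓ ≤ zs ℓ ∧ zs ℓ ≤ zts ℓ ∧ zts ℓ ≤ zt₀ ℓ) ∧
      (∀ ℓ ∈ Icc a b,
        zs ℓ = za + ∫ ρ in a..ℓ,
          Φ' ρ * (Φ ℓ - Φ ρ) ^ (μ - 1) *
            mittagLeffler (μ - κ) μ (-ω * (Φ ℓ - Φ ρ) ^ (μ - κ)) * F ρ (zs ρ)) ∧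
      (∀ ℓ ∈ Icc a b,
        zts ℓ = za + ∫ ρ in a..ℓ,
          Φ' ρ * (Φ ℓ - Φ ρ) ^ (μ - 1) *
            mittagLeffler (μ - κ) μ (-ω * (Φ ℓ - Φ ρ) ^ (μ - κ)) * F ρ (zts ρ)) ∧
      (∀ z : ℝ → ℝ, ContinuousOn z (Icc a b) →
        (∀ ℓ ∈ Icc a b, z₀ ℓ ≤ z ℓ ∧ z ℓ ≤ zt₀ ℓ) →
        (∀ ℓ ∈ Icc a b,
          z ℓ = za + ∫ ρ in a..ℓ,
            Φ' ρ * (Φ ℓ - Φ ρ) ^ (μ - 1) *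
              mittagLeffler (μ - κ) μ (-ω * (Φ ℓ - Φ ρ) ^ (μ - κ)) * F ρ (z ρ)) →
        ∀ ℓ ∈ Icc a b, zs ℓ ≤ z ℓ ∧ z ℓ ≤ zts ℓ) := by
  have h : IsTimeChange Φ Φ' a b := ⟨hΦd, hΦ'c, hΦ'pos⟩
  have hW : IsVolterraKernel (fun l ρ => Φ' ρ * solutionKernel μ κ ω (Φ l - Φ ρ)) a b :=
    h.isVolterraKernel (fun t ht => (solutionKernel_pos hκ0 hκμ hμ1 hω ht).le)
      (fun t ht => (differentiableAt_solutionKernel hκ0 hκμ ht).continuousAt.continuousWithinAt)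
      (integrableOn_solutionKernel hκ0 hκμ)
  have hz₀c : ContinuousOn z₀ (Icc a b) := fun x hx =>
    (hz₀d x hx).continuousAt.continuousWithinAt
  have hzt₀c : ContinuousOn zt₀ (Icc a b) := fun x hx =>
    (hzt₀d x hx).continuousAt.continuousWithinAt
  have hFz : ∀ x : ℝ → ℝ, ContinuousOn x (Icc a b) →
      ContinuousOn (fun ρ => F ρ (x ρ)) (Icc a b) := fun x hx =>
    hFc.comp (continuousOn_id.prodMk hx) fun ρ hρ => ⟨hρ, mem_univ _⟩
  have hmem : ∀ ℓ ∈ Icc a b, ∀ ρ ∈ Ioo a ℓ, ρ ∈ Icc a b := fun ℓ hℓ ρ hρ =>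
    ⟨hρ.1.le, hρ.2.le.trans hℓ.2⟩
  have hsub : ∀ ℓ ∈ Icc a b, z₀ ℓ ≤
      za + ∫ ρ in Ioo a ℓ, Φ' ρ * solutionKernel μ κ ω (Φ ℓ - Φ ρ) * F ρ (z₀ ρ) := by
    intro ℓ hℓ
    obtain ⟨hi, he⟩ := h.integral_solutionKernel_mul_caputo hκ0 hκμ hμ1 hω hz₀d hz₀'c hℓ
    have hle := setIntegral_mono_on hi (hW.integrableOn_mul (hFz z₀ hz₀c) hℓ) measurableSet_Ioo
      fun ρ hρ => mul_le_mul_of_nonneg_left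
        (h.caputo_eq_integral_caputoKernel hκμ hμ1 hz₀'c (hmem ℓ hℓ ρ hρ) ▸
          hlow ρ (hmem ℓ hℓ ρ hρ)) (hW.nonneg ℓ hℓ ρ hρ)
    linarith
  have hsup : ∀ ℓ ∈ Icc a b,
      za + ∫ ρ in Ioo a ℓ, Φ' ρ * solutionKernel μ κ ω (Φ ℓ - Φ ρ) * F ρ (zt₀ ρ) ≤ zt₀ ℓ := by
    intro ℓ hℓ
    obtain ⟨hi, he⟩ := h.integral_solutionKernel_mul_caputo hκ0 hκμ hμ1 hω hzt₀d hzt₀'c hℓ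
    have hle := setIntegral_mono_on (hW.integrableOn_mul (hFz zt₀ hzt₀c) hℓ) hi measurableSet_Ioo
      fun ρ hρ => mul_le_mul_of_nonneg_left
        (h.caputo_eq_integral_caputoKernel hκμ hμ1 hzt₀'c (hmem ℓ hℓ ρ hρ) ▸
          hup ρ (hmem ℓ hℓ ρ hρ)) (hW.nonneg ℓ hℓ ρ hρ)
    linarith
  have heq : ∀ ℓ ∈ Icc a b, ∀ x : ℝ → ℝ,
      (∫ ρ in a..ℓ, Φ' ρ * (Φ ℓ - Φ ρ) ^ (μ - 1) *
        mittagLeffler (μ - κ) μ (-ω * (Φ ℓ - Φ ρ) ^ (μ - κ)) * F ρ (x ρ)) =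
      ∫ ρ in Ioo a ℓ, Φ' ρ * solutionKernel μ κ ω (Φ ℓ - Φ ρ) * F ρ (x ρ) := by
    intro ℓ hℓ x
    rw [intervalIntegral.integral_of_le hℓ.1, integral_Ioc_eq_integral_Ioo]
    simp_rw [solutionKernel, mul_assoc]
  obtain ⟨zs, hzs, hzs_sec, hzs_eq, hzs_least⟩ :=
    hW.exists_least_solution hFc hz₀c hzt₀c hord hFmono hsub hsup
  obtain ⟨zts, hzts, hzts_sec, hzts_eq, hzts_greatest⟩ :=
    hW.exists_greatest_solution hFc hz₀c hzt₀c hord hFmono hsub hsup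
  refine ⟨zs, zts, hzs, hzts, fun ℓ hℓ => ⟨(hzs_sec ℓ hℓ).1,
    hzs_least zts hzts hzts_sec hzts_eq ℓ hℓ, (hzts_sec ℓ hℓ).2⟩,
    fun ℓ hℓ => by rw [heq ℓ hℓ, ← hzs_eq ℓ hℓ], fun ℓ hℓ => by rw [heq ℓ hℓ, ← hzts_eq ℓ hℓ],
    fun z hz hz_sec hz_eq ℓ hℓ => ?_⟩
  have hz_eq' : ∀ ℓ ∈ Icc a b,
      z ℓ = za + ∫ ρ in Ioo a ℓ, Φ' ρ * solutionKernel μ κ ω (Φ ℓ - Φ ρ) * F ρ (z ρ) :=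
    fun ℓ hℓ => by rw [← heq ℓ hℓ, ← hz_eq ℓ hℓ]
  exact ⟨hzs_least z hz hz_sec hz_eq' ℓ hℓ, hzts_greatest z hz hz_sec hz_eq' ℓ hℓ⟩
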